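/- arXiv:1807.04086 — 5 statements merged into one kernel-verified Lean document; each statement's English description precedes it below -/
import Mathlib

section
/- Let Z be an m-thick continuum (m ≥ 2) and let A_1, …, A_k be linearly ordered min cuts of Z such that no wheel of Z contains two of the A_i. Then there are subcontinua M, O, N_1, …, N_{k−1} of Z such that for each i = 1, …, k the pair (M ∪ N_1 ∪ … ∪ N_{i−1}, N_i ∪ … ∪ N_{k−1} ∪ O) is a decomposition of Z by A_i; moreover (A_i ∪ A_{i+1}) \ (A_i ∩ A_{i+1}) ⊆ ∂N_i ⊆ A_i ∪ A_{i+1} and |N_i ∩ A_i| = |N_i ∩ A_{i+1}| for every i = 1, …, k−1. -/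
open Set Topology

variable {Z : Type*}

/-- A subcontinuum of a space: a nonempty compact connected subset. -/
def IsSubcontinuum [TopologicalSpace Z] (A : Set Z) : Prop :=
  IsCompact A ∧ IsConnected A

/-- A space `Z` is `m`-thick: removing fewer than `m` points leaves it connected,
while some set of exactly `m` points disconnects it. -/
def IsThick (Z : Type*) [TopologicalSpace Z] (m : ℕ) : Prop :=
  (∀ A : Set Z, A.Finite → A.ncard < m → IsConnected Aᶜ) ∧
  ∃ A : Set Z, A.Finite ∧ A.ncard = m ∧ ¬ IsPreconnected Aᶜ

/-- A min cut of an `m`-thick space: a set of exactly `m` points whose removal disconnects. -/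
def IsMinCut [TopologicalSpace Z] (m : ℕ) (A : Set Z) : Prop :=
  A.Finite ∧ A.ncard = m ∧ ¬ IsPreconnected Aᶜ

/-- `M, N` is a decomposition of the whole space by the cut `A`. -/
def IsDecompositionBy [TopologicalSpace Z] (M N A : Set Z) : Prop :=
  IsSubcontinuum M ∧ IsSubcontinuum N ∧ M ∪ N = univ ∧ M ∩ N = A

/-- A wheel decomposition of the whole space by the finite set `W`. -/
def IsWheelDecomp [TopologicalSpace Z] (m : ℕ) (W : Set Z) (n : ℕ)
    (M : Fin n → Set Z) : Prop :=
  3 < n ∧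
  (∀ i, IsSubcontinuum (M i) ∧ ¬ (M i).Subsingleton) ∧
  (⋃ i, M i) = univ ∧
  (⋃ (i) (j) (_ : i ≠ j), M i ∩ M j) = W ∧
  (⋂ i, M i).ncard < m ∧
  (∀ i j : Fin n, i ≠ j → ((i : ℕ) + 1) % n ≠ (j : ℕ) → ((j : ℕ) + 1) % n ≠ (i : ℕ) →
    M i ∩ M j = ⋂ k, M k) ∧
  ∀ i, (M i ∩ W).ncard = m

/-- A finite wheel. -/
def IsFiniteWheel [TopologicalSpace Z] (m : ℕ) (W : Set Z) : Prop :=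
  W.Finite ∧ ∃ n, ∃ M : Fin n → Set Z, IsWheelDecomp m W n M

/-- A wheel: either a finite wheel, or an infinite set all of whose finite subsets lie
in finite wheels contained in it. -/
def IsWheel [TopologicalSpace Z] (m : ℕ) (W : Set Z) : Prop :=
  IsFiniteWheel m W ∨
  (W.Infinite ∧ ∀ F ⊆ W, F.Finite → ∃ W', F ⊆ W' ∧ W' ⊆ W ∧ IsFiniteWheel m W')

/-- The cuts `A 0, …, A (k-1)` are linearly ordered. -/
def LinearlyOrderedCuts [TopologicalSpace Z] {k : ℕ} (A : Fin k → Set Z) : Prop :=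
  ∀ i, ∃ M O : Set Z, IsDecompositionBy M O (A i) ∧
    (∀ j, j < i → A j ⊆ M) ∧ ∀ j, i < j → A j ⊆ O

/-- `S` is between the min cuts `A₁` and `A₂`. -/
def IsBetweenCuts [TopologicalSpace Z] (S A₁ A₂ : Set Z) : Prop :=
  (∀ M N : Set Z, IsDecompositionBy M N A₁ → A₂ ∪ S ⊆ M ∨ A₂ ∪ S ⊆ N) ∧
  ∀ M N : Set Z, IsDecompositionBy M N A₂ → A₁ ∪ S ⊆ M ∨ A₁ ∪ S ⊆ N


section Decomposition

variable [TopologicalSpace Z]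

lemma IsSubcontinuum.isClosed [T2Space Z] {M : Set Z} (h : IsSubcontinuum M) : IsClosed M :=
  h.1.isClosed

lemma IsDecompositionBy.symm {M O A : Set Z} (h : IsDecompositionBy M O A) :
    IsDecompositionBy O M A :=
  ⟨h.2.1, h.1, by rw [union_comm, h.2.2.1], by rw [inter_comm, h.2.2.2]⟩

lemma IsDecompositionBy.mem_or_mem {M O A : Set Z} (h : IsDecompositionBy M O A) (x : Z) :
    x ∈ M ∨ x ∈ O := by
  have : x ∈ M ∪ O := h.2.2.1 ▸ mem_univ x
  exact this

lemma IsDecompositionBy.mem_iff {M O A : Set Z} (h : IsDecompositionBy M O A) (x : Z) :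
    x ∈ A ↔ x ∈ M ∧ x ∈ O := by
  rw [← h.2.2.2]; rfl

/-- In an `m`-thick space, an open set that is neither empty nor dense has at least `m`
frontier points. -/
lemma IsThick.le_ncard_of_frontier_subset {m : ℕ} (h : IsThick Z m) {U F : Set Z}
    (hU : IsOpen U) (hne : U.Nonempty) (hne' : (closure U)ᶜ.Nonempty) (hF : F.Finite)
    (hUF : frontier U ⊆ F) : m ≤ F.ncard := by
  refine le_trans ?_ (ncard_le_ncard hUF hF)
  by_contra! hlt
  have hc := (h.1 _ (hF.subset hUF) hlt).isPreconnected
  have hfr : frontier U = closure U \ U := hU.frontier_eq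
  obtain ⟨x, -, hx, hx'⟩ := hc U (closure U)ᶜ hU isClosed_closure.isOpen_compl
    (fun x hx => by
      by_cases hxc : x ∈ closure U
      · left
        by_contra hxU
        exact hx (hfr ▸ ⟨hxc, hxU⟩)
      · exact Or.inr hxc)
    (by
      obtain ⟨x, hx⟩ := hne
      exact ⟨x, fun hx' => (hfr ▸ hx' : x ∈ closure U \ U).2 hx, hx⟩)
    (by
      obtain ⟨x, hx⟩ := hne'
      exact ⟨x, fun hx' => hx (hfr ▸ hx' : x ∈ closure U \ U).1, hx⟩)
  exact hx' (subset_closure hx)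

lemma IsMinCut.ncard_inter_lt {m : ℕ} {A₁ A₂ : Set Z} (h₁ : IsMinCut m A₁)
    (h₂ : IsMinCut m A₂) (hne : A₁ ≠ A₂) : (A₁ ∩ A₂).ncard < m := by
  by_contra! hle
  have e₁ : A₁ ∩ A₂ = A₁ := eq_of_subset_of_ncard_le inter_subset_left (h₁.2.1 ▸ hle) h₁.1
  have e₂ : A₁ ∩ A₂ = A₂ := eq_of_subset_of_ncard_le inter_subset_right (h₂.2.1 ▸ hle) h₂.1
  exact hne (e₁.symm.trans e₂)

/-- Four subcontinua arranged in a circle, with nonadjacent ones disjoint, form a wheel. -/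
lemma isWheel_of_four {m : ℕ} (hm : 0 < m) {P X Q Y W : Set Z} (hW : W.Finite)
    (hP : IsSubcontinuum P) (hX : IsSubcontinuum X) (hQ : IsSubcontinuum Q)
    (hY : IsSubcontinuum Y) (hP' : ¬ P.Subsingleton) (hX' : ¬ X.Subsingleton)
    (hQ' : ¬ Q.Subsingleton) (hY' : ¬ Y.Subsingleton) (hcov : P ∪ X ∪ Q ∪ Y = univ)
    (hPQ : P ∩ Q = ∅) (hXY : X ∩ Y = ∅) (hcut : (P ∪ Q) ∩ (X ∪ Y) = W)
    (hPc : (P ∩ W).ncard = m) (hXc : (X ∩ W).ncard = m) (hQc : (Q ∩ W).ncard = m)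
    (hYc : (Y ∩ W).ncard = m) : IsWheel m W := by
  have hI : ⋂ i, (![P, X, Q, Y] : Fin 4 → Set Z) i = ∅ := by
    refine eq_empty_of_subset_empty fun x hx => ?_
    rw [mem_iInter] at hx
    exact hPQ ▸ (⟨hx 0, hx 2⟩ : x ∈ P ∩ Q)
  have hQP : Q ∩ P = ∅ := inter_comm P Q ▸ hPQ
  have hYX : Y ∩ X = ∅ := inter_comm X Y ▸ hXY
  refine Or.inl ⟨hW, 4, ![P, X, Q, Y], by norm_num, ?_, ?_, ?_, ?_, ?_, ?_⟩
  · simp [Fin.forall_fin_succ, -not_subsingleton_iff, *]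
  · refine eq_univ_of_forall fun x => ?_
    have hx : x ∈ P ∪ X ∪ Q ∪ Y := hcov ▸ mem_univ x
    simp only [mem_iUnion, Fin.exists_fin_succ]
    simp only [mem_union] at hx
    simp
    tauto
  · ext x
    have hpq : ¬ (x ∈ P ∧ x ∈ Q) := fun h => (hPQ ▸ h : x ∈ (∅ : Set Z))
    have hxy : ¬ (x ∈ X ∧ x ∈ Y) := fun h => (hXY ▸ h : x ∈ (∅ : Set Z))
    rw [← hcut]
    simp only [mem_iUnion, Fin.exists_fin_succ]
    simp [Fin.ext_iff]
    tauto
  · rw [hI]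
    simpa using hm
  · rw [hI]
    intro i j
    fin_cases i <;> fin_cases j <;> simp [*]
  · simp [Fin.forall_fin_succ, *]

/-- If the closure of an open set whose frontier lies in the finite set `W` is split into
disjoint closed pieces, then each nonempty piece has at least `m` points in `W`. -/
lemma IsThick.le_ncard_inter_of_split {m : ℕ} (hthick : IsThick Z m) {U W X Y : Set Z}
    (hU : IsOpen U) (hne : (closure U)ᶜ.Nonempty) (hW : W.Finite) (hUW : frontier U ⊆ W)
    (hX : IsClosed X) (hY : IsClosed Y) (hXY : Disjoint X Y) (hcov : closure U = X ∪ Y)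
    (hXne : X.Nonempty) : m ≤ (X ∩ W).ncard := by
  have hsub : U \ Y ⊆ X := fun x hx =>
    (hcov ▸ subset_closure hx.1 : x ∈ X ∪ Y).resolve_right hx.2
  have hopen : IsOpen (U \ Y) := hU.sdiff hY
  have hcl : closure (U \ Y) ⊆ X := closure_minimal hsub hX
  refine hthick.le_ncard_of_frontier_subset hopen ?_ ?_ (hW.inter_of_right X) ?_
  · obtain ⟨x, hx⟩ := hXne
    have hxU : x ∈ closure U := hcov ▸ Or.inl hx
    obtain ⟨y, hy, hyU⟩ := mem_closure_iff.1 hxU Yᶜ hY.isOpen_compl (disjoint_left.1 hXY hx)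
    exact ⟨y, hyU, hy⟩
  · exact hne.mono (compl_subset_compl.2 (closure_mono sdiff_subset))
  · rw [hopen.frontier_eq]
    rintro x ⟨hx, hx'⟩
    refine ⟨hcl hx, hUW ?_⟩
    rw [hU.frontier_eq]
    exact ⟨closure_mono sdiff_subset hx, fun hxU => hx' ⟨hxU, disjoint_left.1 hXY (hcl hx)⟩⟩

/-- A closed set which is not preconnected splits into two disjoint nonempty closed sets. -/
lemma exists_closed_split_of_not_isPreconnected {N : Set Z} (hN : IsClosed N)
    (h : ¬ IsPreconnected N) : ∃ X Y : Set Z, IsClosed X ∧ IsClosed Y ∧ Disjoint X Y ∧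
      N = X ∪ Y ∧ X.Nonempty ∧ Y.Nonempty := by
  rw [isPreconnected_closed_iff] at h
  push Not at h
  obtain ⟨t, t', ht, ht', hsub, hne, hne', hemp⟩ := h
  refine ⟨N ∩ t, N ∩ t', hN.inter ht, hN.inter ht', ?_, ?_, hne, hne'⟩
  · rw [disjoint_iff_inter_eq_empty, ← inter_inter_distrib_left]
    exact hemp
  · rw [← inter_union_distrib_left, inter_eq_left.2 hsub]

/-- If the frontier of an open set lies in a finite set with at most `2 * m` points, then either
the closure of that open set is preconnected, or it is the disjoint union of two connected pieces,
each of which meets the finite set in exactly `m` points. -/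
lemma IsThick.isPreconnected_closure_or_split {m : ℕ} (hm : 0 < m) (hthick : IsThick Z m)
    {U W : Set Z} (hU : IsOpen U) (hne : (closure U)ᶜ.Nonempty) (hW : W.Finite)
    (hUW : frontier U ⊆ W) (hWc : W.ncard ≤ 2 * m) :
    IsPreconnected (closure U) ∨ ∃ X Y : Set Z, IsClosed X ∧ IsClosed Y ∧ IsConnected X ∧
      IsConnected Y ∧ Disjoint X Y ∧ closure U = X ∪ Y ∧ W ⊆ closure U ∧ W.ncard = 2 * m ∧
      (X ∩ W).ncard = m ∧ (Y ∩ W).ncard = m := by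
  refine or_iff_not_imp_left.2 fun hnot => ?_
  obtain ⟨X, Y, hX, hY, hXY, hcov, hXne, hYne⟩ :=
    exists_closed_split_of_not_isPreconnected isClosed_closure hnot
  have hsplit := fun {X Y : Set Z} => hthick.le_ncard_inter_of_split (X := X) (Y := Y)
    hU hne hW hUW
  have hadd : ∀ {S T : Set Z}, Disjoint S T →
      ((S ∪ T) ∩ W).ncard = (S ∩ W).ncard + (T ∩ W).ncard := fun {S T} hST => by
    rw [union_inter_distrib_right]
    exact ncard_union_eq (hST.mono inter_subset_left inter_subset_left)
      (hW.inter_of_right S) (hW.inter_of_right T)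
  have hconn : ∀ {X Y : Set Z}, IsClosed X → IsClosed Y → Disjoint X Y → closure U = X ∪ Y →
      X.Nonempty → Y.Nonempty → IsConnected X := by
    intro X Y hX hY hXY hcov hXne hYne
    refine ⟨hXne, by_contra fun hnc => ?_⟩
    obtain ⟨S, T, hS, hT, hST, rfl, hSne, hTne⟩ :=
      exists_closed_split_of_not_isPreconnected hX hnc
    rw [disjoint_union_left] at hXY
    have hS' := hsplit hS (hT.union hY) (disjoint_union_right.2 ⟨hST, hXY.1⟩)
      (by rw [hcov, union_assoc]) hSne
    have hT' := hsplit hT (hS.union hY) (disjoint_union_right.2 ⟨hST.symm, hXY.2⟩)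
      (by rw [hcov, ← union_assoc, union_comm S]) hTne
    have hY' := hsplit hY hX (disjoint_union_left.2 hXY).symm
      (by rw [hcov, union_comm]) hYne
    have htot := ncard_le_ncard (inter_subset_right : (S ∪ T ∪ Y) ∩ W ⊆ W) hW
    rw [hadd (disjoint_union_left.2 hXY), hadd hST] at htot
    omega
  have hX' := hsplit hX hY hXY hcov hXne
  have hY' := hsplit hY hX hXY.symm (by rw [hcov, union_comm]) hYne
  have htot := ncard_le_ncard (inter_subset_right : (X ∪ Y) ∩ W ⊆ W) hW
  have hsum := hadd hXY
  refine ⟨X, Y, hX, hY, hconn hX hY hXY hcov hXne hYne,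
    hconn hY hX hXY.symm (by rw [hcov, union_comm]) hYne hXne, hXY, hcov, ?_, ?_, ?_, ?_⟩
  · rw [hcov, ← inter_eq_right]
    exact eq_of_subset_of_ncard_le inter_subset_right (by omega) hW
  all_goals omega

section Hausdorff

variable [T2Space Z]

lemma IsDecompositionBy.compl_nonempty {M O A : Set Z} (h : IsDecompositionBy M O A)
    (hA : A.Finite) (hc : 2 ≤ A.ncard) : Mᶜ.Nonempty := by
  by_contra hemp
  rw [not_nonempty_iff_eq_empty, compl_empty_iff] at hemp
  have hO : O = A := by rw [← h.2.2.2, hemp, univ_inter]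
  have hnt : O.Nontrivial := by
    rw [hO, ← one_lt_ncard_iff_nontrivial_and_finite.trans (and_iff_left hA)]
    omega
  exact h.2.1.2.isPreconnected.infinite_of_nontrivial hnt (hO ▸ hA)

lemma IsDecompositionBy.closure_compl_subset {M O A : Set Z} (h : IsDecompositionBy M O A) :
    closure Mᶜ ⊆ O :=
  closure_minimal (fun x hx => (h.mem_or_mem x).resolve_left hx) h.2.1.isClosed

lemma IsDecompositionBy.subset_closure_compl {m : ℕ} (hm : 2 ≤ m) (hthick : IsThick Z m)
    {M O A : Set Z} (h : IsDecompositionBy M O A) (hA : IsMinCut m A) : A ⊆ closure Mᶜ := by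
  have hopen : IsOpen Mᶜ := h.1.isClosed.isOpen_compl
  have hsub : frontier Mᶜ ⊆ A := by
    rw [hopen.frontier_eq]
    rintro x ⟨hx, hx'⟩
    exact (h.mem_iff x).2 ⟨not_not.1 hx', h.closure_compl_subset hx⟩
  have hfin := hA.1.subset hsub
  have hle := hthick.le_ncard_of_frontier_subset hopen
    (h.compl_nonempty hA.1 (hA.2.1 ▸ hm))
    ((h.symm.compl_nonempty hA.1 (hA.2.1 ▸ hm)).mono (compl_subset_compl.2 h.closure_compl_subset))
    hfin subset_rfl
  rw [← eq_of_subset_of_ncard_le hsub (hA.2.1 ▸ hle) hA.1]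
  exact frontier_subset_closure

/-- Two distinct noncrossing min cuts have nested decompositions. -/
lemma IsDecompositionBy.nested {m : ℕ} (hm : 2 ≤ m) (hthick : IsThick Z m)
    {M₁ O₁ A₁ M₂ O₂ A₂ : Set Z} (h₁ : IsDecompositionBy M₁ O₁ A₁)
    (h₂ : IsDecompositionBy M₂ O₂ A₂) (hA₁ : IsMinCut m A₁) (hA₂ : IsMinCut m A₂)
    (hne : A₁ ≠ A₂) (h12 : A₁ ⊆ M₂) (h21 : A₂ ⊆ O₁) : M₁ ⊆ M₂ := by
  by_contra hM
  have hUo : IsOpen (O₁ᶜ ∩ M₂ᶜ) :=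
    h₁.2.1.isClosed.isOpen_compl.inter h₂.1.isClosed.isOpen_compl
  have hcl₁ : closure (O₁ᶜ ∩ M₂ᶜ) ⊆ M₁ :=
    (closure_mono inter_subset_left).trans h₁.symm.closure_compl_subset
  have hcl₂ : closure (O₁ᶜ ∩ M₂ᶜ) ⊆ O₂ :=
    (closure_mono inter_subset_right).trans h₂.closure_compl_subset
  refine (hA₁.ncard_inter_lt hA₂ hne).not_ge (hthick.le_ncard_of_frontier_subset hUo ?_ ?_
    (hA₁.1.inter_of_left A₂) ?_)
  · obtain ⟨x, hx₁, hx₂⟩ := not_subset.1 hM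
    exact ⟨x, fun hxO => hx₂ (h12 ((h₁.mem_iff x).2 ⟨hx₁, hxO⟩)), hx₂⟩
  · exact (h₁.compl_nonempty hA₁.1 (hA₁.2.1 ▸ hm)).mono (compl_subset_compl.2 hcl₁)
  · rw [hUo.frontier_eq]
    rintro x ⟨hx, hx'⟩
    have hxM := hcl₁ hx
    have hxO := hcl₂ hx
    have e₁ := h₁.mem_iff x
    have e₂ := h₂.mem_iff x
    have i₁ := @h12 x
    have i₂ := @h21 x
    simp only [mem_inter_iff, mem_compl_iff] at hx' ⊢
    tauto

/-- The part of the space between two nested decompositions by distinct min cuts that do not lie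
in a common wheel is filled by a subcontinuum. -/
lemma IsDecompositionBy.exists_link [CompactSpace Z] {m : ℕ} (hm : 2 ≤ m)
    (hthick : IsThick Z m)
    {M₁ O₁ A₁ M₂ O₂ A₂ : Set Z} (h₁ : IsDecompositionBy M₁ O₁ A₁)
    (h₂ : IsDecompositionBy M₂ O₂ A₂) (hA₁ : IsMinCut m A₁) (hA₂ : IsMinCut m A₂)
    (hne : A₁ ≠ A₂) (h12 : A₁ ⊆ M₂) (h21 : A₂ ⊆ O₁) (hwheel : ¬ IsWheel m (A₁ ∪ A₂)) :
    ∃ N : Set Z, IsSubcontinuum N ∧ M₁ ∪ N = M₂ ∧ N ∪ O₂ = O₁ ∧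
      (A₁ ∪ A₂) \ (A₁ ∩ A₂) ⊆ frontier N ∧ frontier N ⊆ A₁ ∪ A₂ := by
  have hM : M₁ ⊆ M₂ := h₁.nested hm hthick h₂ hA₁ hA₂ hne h12 h21
  have hO : O₂ ⊆ O₁ := h₂.symm.nested hm hthick h₁.symm hA₂ hA₁ hne.symm h21 h12
  have e₁ := h₁.mem_iff
  have e₂ := h₂.mem_iff
  set U : Set Z := M₁ᶜ ∩ O₂ᶜ with hUdef
  have hUo : IsOpen U := h₁.1.isClosed.isOpen_compl.inter h₂.2.1.isClosed.isOpen_compl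
  have hcO : closure U ⊆ O₁ := (closure_mono inter_subset_left).trans h₁.closure_compl_subset
  have hcM : closure U ⊆ M₂ :=
    (closure_mono inter_subset_right).trans h₂.symm.closure_compl_subset
  have hfr : closure U \ U ⊆ A₁ ∪ A₂ := by
    rintro x ⟨hx, hx'⟩
    rw [mem_union, e₁, e₂]
    have i₁ := hcO hx
    have i₂ := hcM hx
    by_cases hxM : x ∈ M₁
    · exact Or.inl ⟨hxM, i₁⟩
    · exact Or.inr ⟨i₂, by_contra fun h => hx' ⟨hxM, h⟩⟩
  have hD₁ : A₁ \ A₂ ⊆ closure U := by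
    rintro x ⟨hx, hx'⟩
    rw [hUdef, inter_comm]
    exact h₂.2.1.isClosed.isOpen_compl.inter_closure
      ⟨fun h => hx' ((e₂ x).2 ⟨h12 hx, h⟩), h₁.subset_closure_compl hm hthick hA₁ hx⟩
  have hD₂ : A₂ \ A₁ ⊆ closure U := by
    rintro x ⟨hx, hx'⟩
    exact h₁.1.isClosed.isOpen_compl.inter_closure
      ⟨fun h => hx' ((e₁ x).2 ⟨h, h21 hx⟩), h₂.symm.subset_closure_compl hm hthick hA₂ hx⟩
  have hncl : (closure U)ᶜ.Nonempty :=
    (h₁.symm.compl_nonempty hA₁.1 (hA₁.2.1 ▸ hm)).mono (compl_subset_compl.2 hcO)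
  have hWfin : (A₁ ∪ A₂).Finite := hA₁.1.union hA₂.1
  have hWcard : (A₁ ∪ A₂).ncard + (A₁ ∩ A₂).ncard = 2 * m := by
    rw [ncard_union_add_ncard_inter A₁ A₂ hA₁.1 hA₂.1, hA₁.2.1, hA₂.2.1]
    ring
  have hpre : IsPreconnected (closure U) := by
    refine (hthick.isPreconnected_closure_or_split (by omega) hUo hncl hWfin
      (hUo.frontier_eq ▸ hfr) (by omega)).resolve_right ?_
    rintro ⟨X, Y, hX, hY, hXc, hYc, hXY, hcov, hWU, hW2, hXm, hYm⟩
    have hI : A₁ ∩ A₂ = ∅ := by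
      rw [← ncard_eq_zero (hA₁.1.inter_of_left A₂)]
      omega
    have hnt : ∀ {S T : Set Z}, (S ∩ T).ncard = m → ¬ S.Subsingleton := fun {S T} h hS => by
      have hST := hS.anti (inter_subset_left : S ∩ T ⊆ S)
      have := hST.finite.to_subtype
      have := ncard_le_one_iff_subsingleton.2 hST
      omega
    have hPc : (M₁ ∩ (A₁ ∪ A₂)).ncard = m := by
      rw [← hA₁.2.1]
      congr 1
      ext x
      have := @h21 x
      have := e₁ x
      simp only [mem_inter_iff, mem_union]
      tauto
    have hQc : (O₂ ∩ (A₁ ∪ A₂)).ncard = m := by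
      rw [← hA₂.2.1]
      congr 1
      ext x
      have := @h12 x
      have := e₂ x
      simp only [mem_inter_iff, mem_union]
      tauto
    refine hwheel (isWheel_of_four (P := M₁) (X := X) (Q := O₂) (Y := Y) (by omega) hWfin h₁.1
      ⟨hX.isCompact, hXc⟩ h₂.2.1 ⟨hY.isCompact, hYc⟩ (hnt hPc) (hnt hXm) (hnt hQc) (hnt hYm)
      ?_ ?_ hXY.inter_eq ?_ hPc hXm hQc hYm)
    · refine eq_univ_of_forall fun x => ?_
      have hx : x ∈ U → x ∈ X ∪ Y := fun h => hcov ▸ subset_closure h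
      simp only [hUdef, mem_inter_iff, mem_compl_iff, mem_union] at hx ⊢
      tauto
    · refine eq_empty_of_subset_empty fun x hx => ?_
      have hx₂ := (e₂ x).2 ⟨hM hx.1, hx.2⟩
      exact hI ▸ (⟨(e₁ x).2 ⟨hx.1, h21 hx₂⟩, hx₂⟩ : x ∈ A₁ ∩ A₂)
    · rw [← hcov]
      refine Subset.antisymm (fun x hx => hfr ⟨hx.2, fun h => ?_⟩) fun x hx => ⟨?_, hWU hx⟩
      · exact hx.1.elim h.1 h.2
      · exact hx.imp (fun h => ((e₁ x).1 h).1) fun h => ((e₂ x).1 h).2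
  have hUne : (closure U).Nonempty := by
    by_contra hemp
    rw [not_nonempty_iff_eq_empty] at hemp
    rw [hemp, subset_empty_iff, sdiff_eq_empty] at hD₁ hD₂
    exact hne (hD₁.antisymm hD₂)
  have hmem : ∀ x, x ∈ M₂ → x ∈ O₁ → x ∈ M₁ ∧ x ∈ O₂ ∨ x ∈ closure U := by
    intro x hx₂ hx₁
    have i₁ := @hD₁ x
    have i₂ := @hD₂ x
    have i₃ : x ∈ U → x ∈ closure U := fun h => subset_closure h
    have j₁ := e₁ x
    have j₂ := e₂ x
    simp only [hUdef, mem_inter_iff, mem_compl_iff, mem_sdiff] at i₁ i₂ i₃ ⊢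
    tauto
  refine ⟨closure U, ⟨isClosed_closure.isCompact, hUne, hpre⟩, ?_, ?_, ?_, ?_⟩
  · refine (union_subset hM hcM).antisymm fun x hx => ?_
    have := hmem x hx
    have := h₁.mem_or_mem x
    simp only [mem_union]
    tauto
  · refine (union_subset hcO hO).antisymm fun x hx => ?_
    have := hmem x
    have := h₂.mem_or_mem x
    simp only [mem_union]
    tauto
  · rw [frontier_eq_closure_inter_closure, closure_closure]
    rintro x ⟨hx | hx, hx'⟩
    · refine ⟨hD₁ ⟨hx, fun h => hx' ⟨hx, h⟩⟩, closure_mono (compl_subset_compl.2 hcO) ?_⟩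
      exact h₁.symm.subset_closure_compl hm hthick hA₁ hx
    · refine ⟨hD₂ ⟨hx, fun h => hx' ⟨h, hx⟩⟩, closure_mono (compl_subset_compl.2 hcM) ?_⟩
      exact h₂.subset_closure_compl hm hthick hA₂ hx
  · refine subset_trans ?_ hfr
    rw [isClosed_closure.frontier_eq]
    exact sdiff_subset_sdiff_right (interior_maximal subset_closure hUo)

end Hausdorff

/-- For linearly ordered min cuts, the witnessing decompositions can be chosen to depend only on
the cut and not on its index. -/
lemma LinearlyOrderedCuts.exists_decomposition {m k : ℕ} {A : Fin k → Set Z}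
    (hmin : ∀ i, IsMinCut m (A i)) (hlin : LinearlyOrderedCuts A) :
    ∃ M O : Set Z → Set Z, ∀ i, IsDecompositionBy (M (A i)) (O (A i)) (A i) ∧
      (∀ j, j < i → A j ⊆ M (A i)) ∧ ∀ j, i < j → A j ⊆ O (A i) := by
  have hsandwich : ∀ i j l : Fin k, i < l → l < j → A i = A j → A l = A i := by
    intro i j l hil hlj hij
    obtain ⟨M, O, h, hM, hO⟩ := hlin l
    refine (eq_of_subset_of_ncard_le
      (fun x hx => (h.mem_iff x).2 ⟨hM i hil hx, hO j hlj (hij ▸ hx)⟩)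
      ?_ (hmin l).1).symm
    rw [(hmin l).2.1, (hmin i).2.1]
  have key : ∀ B : Set Z, ∃ M O : Set Z, ∀ i, A i = B → IsDecompositionBy M O B ∧
      (∀ j, j < i → A j ⊆ M) ∧ ∀ j, i < j → A j ⊆ O := by
    intro B
    by_cases hB : ∃ l, A l = B
    · obtain ⟨l, rfl⟩ := hB
      obtain ⟨M, O, h, hM, hO⟩ := hlin l
      have hAM : A l ⊆ M := fun x hx => ((h.mem_iff x).1 hx).1
      have hAO : A l ⊆ O := fun x hx => ((h.mem_iff x).1 hx).2
      refine ⟨M, O, fun i hi => ⟨h, fun j hj => ?_, fun j hj => ?_⟩⟩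
      · rcases lt_trichotomy j l with hjl | rfl | hjl
        · exact hM j hjl
        · exact hAM
        · rwa [hsandwich l i j hjl hj hi.symm]
      · rcases lt_trichotomy l j with hjl | rfl | hjl
        · exact hO j hjl
        · exact hAO
        · rwa [hsandwich i l j hj hjl hi, hi]
    · exact ⟨∅, ∅, fun i hi => (hB ⟨i, hi⟩).elim⟩
  choose M O h using key
  exact ⟨M, O, fun i => h (A i) i rfl⟩

end Decomposition

lemma ncard_inter_eq_of_symmDiff_subset {α : Type*} {N A B : Set α} (hA : A.Finite)
    (hB : B.Finite) (hcard : A.ncard = B.ncard) (h : (A ∪ B) \ (A ∩ B) ⊆ N) :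
    (N ∩ A).ncard = (N ∩ B).ncard := by
  have key : ∀ {A B : Set α}, A.Finite → (A ∪ B) \ (A ∩ B) ⊆ N →
      (N ∩ A).ncard = (N ∩ (A ∩ B)).ncard + (A.ncard - (A ∩ B).ncard) := by
    intro A B hA h
    have hs : N ∩ A = (N ∩ (A ∩ B)) ∪ (A \ (A ∩ B)) := by
      ext x
      have := @h x
      simp only [mem_inter_iff, mem_union, mem_sdiff] at this ⊢
      tauto
    rw [hs, ncard_union_eq (disjoint_sdiff_right.mono_left inter_subset_right)
      ((hA.inter_of_left B).inter_of_right N) hA.sdiff,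
      ncard_sdiff inter_subset_left (hA.inter_of_left B)]
  rw [key hA h, key hB (by rwa [union_comm, inter_comm] at h), inter_comm B A, hcard]

/-- **Lemma (between).** Let `A 0, …, A (k-1)` be linearly ordered min cuts of an `m`-thick
continuum `Z` (`m ≥ 2`) such that no wheel contains two of them.  Then there are subcontinua
`M`, `O` and `N 0, …, N (k-2)` such that for each `i` the pair
`(M ∪ N 0 ∪ ⋯ ∪ N (i-1), N i ∪ ⋯ ∪ N (k-2) ∪ O)` is a decomposition of `Z` by `A i`;
moreover `(A i ∪ A (i+1)) \ (A i ∩ A (i+1)) ⊆ ∂(N i) ⊆ A i ∪ A (i+1)` and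
`|N i ∩ A i| = |N i ∩ A (i+1)|` for all `i`. -/
theorem between [MetricSpace Z] [CompactSpace Z] [ConnectedSpace Z] [Nonempty Z]
    {m k : ℕ} (hm : 2 ≤ m) (hthick : IsThick Z m)
    (A : Fin k → Set Z) (hmin : ∀ i, IsMinCut m (A i))
    (hlin : LinearlyOrderedCuts A)
    (hwheel : ∀ W : Set Z, IsWheel m W → ∀ i j : Fin k, i ≠ j → ¬(A i ⊆ W ∧ A j ⊆ W)) :
    ∃ M O : Set Z, ∃ N : ℕ → Set Z,
      IsSubcontinuum M ∧ IsSubcontinuum O ∧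
      (∀ i : ℕ, i + 1 < k → IsSubcontinuum (N i)) ∧
      (∀ i : Fin k, IsDecompositionBy
        (M ∪ ⋃ (j : ℕ) (_ : j < (i : ℕ)), N j)
        ((⋃ (j : ℕ) (_ : (i : ℕ) ≤ j ∧ j + 1 < k), N j) ∪ O) (A i)) ∧
      ∀ i : ℕ, ∀ hi : i + 1 < k,
        (A ⟨i, Nat.lt_of_succ_lt hi⟩ ∪ A ⟨i + 1, hi⟩) \
            (A ⟨i, Nat.lt_of_succ_lt hi⟩ ∩ A ⟨i + 1, hi⟩) ⊆ frontier (N i) ∧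
        frontier (N i) ⊆ A ⟨i, Nat.lt_of_succ_lt hi⟩ ∪ A ⟨i + 1, hi⟩ ∧
        (N i ∩ A ⟨i, Nat.lt_of_succ_lt hi⟩).ncard = (N i ∩ A ⟨i + 1, hi⟩).ncard := by
  obtain ⟨M, O, hMO⟩ := hlin.exists_decomposition hmin
  rcases Nat.eq_zero_or_pos k with rfl | hk
  · exact ⟨univ, univ, fun _ => ∅, ⟨isCompact_univ, isConnected_univ⟩,
      ⟨isCompact_univ, isConnected_univ⟩, fun i hi => by omega, fun i => i.elim0,
      fun i hi => by omega⟩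
  have hlink : ∀ i : ℕ, ∃ N : Set Z, ∀ hi : i + 1 < k,
      IsSubcontinuum N ∧
      M (A ⟨i, Nat.lt_of_succ_lt hi⟩) ∪ N = M (A ⟨i + 1, hi⟩) ∧
      N ∪ O (A ⟨i + 1, hi⟩) = O (A ⟨i, Nat.lt_of_succ_lt hi⟩) ∧
      (A ⟨i, Nat.lt_of_succ_lt hi⟩ ∪ A ⟨i + 1, hi⟩) \
        (A ⟨i, Nat.lt_of_succ_lt hi⟩ ∩ A ⟨i + 1, hi⟩) ⊆ frontier N ∧
      frontier N ⊆ A ⟨i, Nat.lt_of_succ_lt hi⟩ ∪ A ⟨i + 1, hi⟩ := by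
    intro i
    by_cases hi : i + 1 < k
    swap
    · exact ⟨∅, fun h => (hi h).elim⟩
    obtain ⟨h₁, -, h₁O⟩ := hMO ⟨i, Nat.lt_of_succ_lt hi⟩
    obtain ⟨h₂, h₂M, -⟩ := hMO ⟨i + 1, hi⟩
    have hlt : (⟨i, Nat.lt_of_succ_lt hi⟩ : Fin k) < ⟨i + 1, hi⟩ := Nat.lt_succ_self i
    by_cases heq : A ⟨i, Nat.lt_of_succ_lt hi⟩ = A ⟨i + 1, hi⟩
    · have hAne : (A ⟨i + 1, hi⟩).Nonempty := by
        apply nonempty_of_ncard_ne_zero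
        rw [(hmin _).2.1]
        omega
      obtain ⟨a, ha⟩ := hAne
      have ha' := (h₂.mem_iff a).1 ha
      refine ⟨{a}, fun _ => ⟨⟨isCompact_singleton, isConnected_singleton⟩, ?_, ?_, ?_, ?_⟩⟩
      · rw [heq]
        exact union_eq_left.2 (singleton_subset_iff.2 ha'.1)
      · rw [heq]
        exact union_eq_right.2 (singleton_subset_iff.2 ha'.2)
      · simp [heq]
      · exact isClosed_singleton.frontier_subset.trans (singleton_subset_iff.2 (Or.inr ha))
    · obtain ⟨N, hN⟩ := h₁.exists_link hm hthick h₂ (hmin _) (hmin _) heq (h₂M _ hlt)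
        (h₁O _ hlt) fun hW => hwheel _ hW _ _ hlt.ne ⟨subset_union_left, subset_union_right⟩
      exact ⟨N, fun _ => hN⟩
  choose N hN using hlink
  have hleft : ∀ i : ℕ, ∀ hi : i < k,
      M (A ⟨0, hk⟩) ∪ ⋃ (j : ℕ) (_ : j < i), N j = M (A ⟨i, hi⟩) := by
    intro i
    induction i with
    | zero => simp
    | succ i ih =>
      intro hi
      rw [biUnion_lt_succ, ← union_assoc, ih (by omega), (hN i hi).2.1]
  have hright : ∀ d i : ℕ, ∀ hi : i < k, i + d + 1 = k →
      (⋃ (j : ℕ) (_ : i ≤ j ∧ j + 1 < k), N j) ∪ O (A ⟨k - 1, by omega⟩) = O (A ⟨i, hi⟩) := by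
    intro d
    induction d with
    | zero =>
      rintro i hi rfl
      have : ⋃ (j : ℕ) (_ : i ≤ j ∧ j + 1 < i + 0 + 1), N j = ∅ := by
        simp only [iUnion_eq_empty]
        rintro j ⟨h, h'⟩
        omega
      rw [this, empty_union]
      rfl
    | succ d ih =>
      intro i hi hd
      have hi' : i + 1 < k := by omega
      have hs : ⋃ (j : ℕ) (_ : i ≤ j ∧ j + 1 < k), N j =
          N i ∪ ⋃ (j : ℕ) (_ : i + 1 ≤ j ∧ j + 1 < k), N j := by
        ext x
        simp only [mem_iUnion, mem_union, exists_prop]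
        constructor
        · rintro ⟨j, ⟨hj, hjk⟩, hx⟩
          rcases hj.eq_or_lt with rfl | hj
          · exact Or.inl hx
          · exact Or.inr ⟨j, ⟨hj, hjk⟩, hx⟩
        · rintro (hx | ⟨j, ⟨hj, hjk⟩, hx⟩)
          · exact ⟨i, ⟨le_rfl, hi'⟩, hx⟩
          · exact ⟨j, ⟨by omega, hjk⟩, hx⟩
      rw [hs, union_assoc, ih (i + 1) hi' (by omega), (hN i hi').2.2.1]
  refine ⟨M (A ⟨0, hk⟩), O (A ⟨k - 1, by omega⟩), N, (hMO _).1.1, (hMO _).1.2.1,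
    fun i hi => (hN i hi).1, fun i => ?_, fun i hi => ?_⟩
  · rw [hleft i i.2, hright (k - 1 - i) i i.2 (by omega)]
    exact (hMO i).1
  · obtain ⟨hsub, -, -, hD, hfr⟩ := hN i hi
    exact ⟨hD, hfr, ncard_inter_eq_of_symmDiff_subset (hmin _).1 (hmin _).1
      ((hmin _).2.1.trans (hmin _).2.1.symm) (hD.trans hsub.isClosed.frontier_subset)⟩
end

section
/- Let Z be an m-thick continuum and let A be a min cut of Z. Suppose B, C is a decomposition of Z by A, D, E is a decomposition of Z by A, and C ∩ D is not contained in A. Then C ∩ D and B ∪ E are subcontinua of Z and the pair (C ∩ D, B ∪ E) is a decomposition of Z by A; in particular C ∩ D is nonempty, closed and connected, (C ∩ D) ∪ (B ∪ E) = Z and (C ∩ D) ∩ (B ∪ E) = A. -/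
open Set Topology

variable {Z : Type*}

/-- If removing any proper subset of `(X ∪ Y) ∩ N` does not disconnect the space, then `X ∪ Y` is
not a disjoint union of closed sets with `Y` nonempty and `X` not contained in `N`. -/
theorem inter_nonempty_of_ssubset_compl_preconnected [TopologicalSpace Z] [PreconnectedSpace Z]
    {X Y N : Set Z} (hX : IsClosed X) (hY : IsClosed Y) (hN : IsClosed N)
    (hcover : X ∪ Y ∪ N = univ) (hpre : ∀ P ⊂ (X ∪ Y) ∩ N, IsPreconnected Pᶜ)
    (hXN : ¬ X ⊆ N) (hYne : Y.Nonempty) : (X ∩ Y).Nonempty := by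
  by_contra hXY
  have hdisj : ∀ z ∈ X, z ∉ Y := fun z hx hy => hXY ⟨z, hx, hy⟩
  have hmem : ∀ z, z ∈ X ∨ z ∈ Y ∨ z ∈ N := fun z => by
    have : z ∈ X ∪ Y ∪ N := hcover ▸ mem_univ z
    simpa [or_assoc] using this
  obtain ⟨x, hxX, hxN⟩ := not_subset.1 hXN
  obtain ⟨y, hyY⟩ := hYne
  by_cases hYN : (Y ∩ N).Nonempty
  · obtain ⟨a, haY, haN⟩ := hYN
    have hss : X ∩ N ⊂ (X ∪ Y) ∩ N :=
      ⟨inter_subset_inter_left _ subset_union_left,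
        fun h => hdisj a (h ⟨Or.inr haY, haN⟩).1 haY⟩
    obtain ⟨z, hz, hzX, hzYN⟩ := isPreconnected_closed_iff.1 (hpre _ hss) X (Y ∪ N) hX
      (hY.union hN) (fun z _ => hmem z) ⟨x, fun h => hxN h.2, hxX⟩
      ⟨y, fun h => hdisj y h.1 hyY, Or.inl hyY⟩
    exact hzYN.elim (hdisj z hzX) fun h => hz ⟨hzX, h⟩
  · obtain ⟨z, -, hzY, hzXN⟩ := isPreconnected_closed_iff.1 (isPreconnected_univ (α := Z)) Y (X ∪ N)
      hY (hX.union hN) (fun z _ => by have := hmem z; simp only [mem_union]; tauto)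
      ⟨y, mem_univ y, hyY⟩ ⟨x, mem_univ x, Or.inl hxX⟩
    exact hzXN.elim (fun h => hdisj z h hzY) fun h => hYN ⟨z, hzY, h⟩

/-- If removing any proper subset of `M ∩ N` does not disconnect the space, where `M` and `N` are
closed sets covering the space and `M` is not contained in `N`, then `M` is connected. -/
theorem isConnected_of_ssubset_compl_preconnected [TopologicalSpace Z] [PreconnectedSpace Z]
    {M N : Set Z} (hM : IsClosed M) (hN : IsClosed N) (hcover : M ∪ N = univ)
    (hpre : ∀ P ⊂ M ∩ N, IsPreconnected Pᶜ) (hMN : ¬ M ⊆ N) : IsConnected M := by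
  obtain ⟨x, hxM, hxN⟩ := not_subset.1 hMN
  refine ⟨⟨x, hxM⟩, isPreconnected_closed_iff.2 fun t t' ht ht' hsub hne hne' => ?_⟩
  have hunion : (M ∩ t) ∪ (M ∩ t') = M := by
    rw [← inter_union_distrib_left, inter_eq_left.2 hsub]
  have hunion' : (M ∩ t') ∪ (M ∩ t) = M := union_comm _ _ ▸ hunion
  rw [inter_inter_distrib_left]
  rcases hsub hxM with hx | hx
  · exact inter_nonempty_of_ssubset_compl_preconnected (hM.inter ht) (hM.inter ht') hN
      (by rwa [hunion]) (by rwa [hunion]) (fun h => hxN (h ⟨hxM, hx⟩)) hne'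
  · rw [inter_comm]
    exact inter_nonempty_of_ssubset_compl_preconnected (hM.inter ht') (hM.inter ht) hN
      (by rwa [hunion']) (by rwa [hunion']) (fun h => hxN (h ⟨hxM, hx⟩)) hne

/-- **Lemma (choosy).** Let `A` be a min cut of the `m`-thick continuum `Z`.  If `B, C` is a
decomposition of `Z` by `A`, `D, E` is a decomposition of `Z` by `A`, and `C ∩ D ⊄ A`, then
`(C ∩ D, B ∪ E)` is a decomposition of `Z` by `A`; in particular `C ∩ D` is nonempty, closed
and connected, `(C ∩ D) ∪ (B ∪ E) = Z` and `(C ∩ D) ∩ (B ∪ E) = A`. -/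
theorem choosy [MetricSpace Z] [CompactSpace Z] [ConnectedSpace Z] [Nonempty Z]
    {m : ℕ} (hthick : IsThick Z m)
    {A B C D E : Set Z} (hA : IsMinCut m A)
    (hBC : IsDecompositionBy B C A) (hDE : IsDecompositionBy D E A)
    (hCD : ¬ C ∩ D ⊆ A) :
    IsSubcontinuum (C ∩ D) ∧ IsSubcontinuum (B ∪ E) ∧
    IsDecompositionBy (C ∩ D) (B ∪ E) A ∧
    (C ∩ D).Nonempty ∧ IsClosed (C ∩ D) ∧ IsConnected (C ∩ D) ∧
    (C ∩ D) ∪ (B ∪ E) = univ ∧ (C ∩ D) ∩ (B ∪ E) = A := by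
  obtain ⟨hAfin, hAcard, hAcut⟩ := hA
  obtain ⟨hB, hC, hBCu, hBCi⟩ := hBC
  obtain ⟨hD, hE, hDEu, hDEi⟩ := hDE
  have hAne : A.Nonempty := by
    by_contra h
    rw [not_nonempty_iff_eq_empty.1 h, compl_empty] at hAcut
    exact hAcut isPreconnected_univ
  have hclosed : IsClosed (C ∩ D) := hC.1.isClosed.inter hD.1.isClosed
  have hcover : (C ∩ D) ∪ (B ∪ E) = univ := by
    refine eq_univ_of_forall fun z => ?_
    have h₁ : z ∈ B ∪ C := hBCu ▸ mem_univ z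
    have h₂ : z ∈ D ∪ E := hDEu ▸ mem_univ z
    simp only [mem_union, mem_inter_iff] at *
    tauto
  have hinter : (C ∩ D) ∩ (B ∪ E) = A := by
    ext z
    have h₁ : z ∈ B ∩ C ↔ z ∈ A := by rw [hBCi]
    have h₂ : z ∈ D ∩ E ↔ z ∈ A := by rw [hDEi]
    simp only [mem_union, mem_inter_iff] at *
    tauto
  have hBE : IsSubcontinuum (B ∪ E) :=
    ⟨hB.1.union hE.1, hB.2.union (hAne.mono fun _ hz =>
      ⟨(hBCi.ge hz).1, (hDEi.ge hz).2⟩) hE.2⟩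
  have hconn : IsConnected (C ∩ D) := by
    refine isConnected_of_ssubset_compl_preconnected hclosed hBE.1.isClosed hcover
      (fun P hP => ?_) fun h => hCD fun z hz => hinter.le ⟨hz, h hz⟩
    rw [hinter] at hP
    exact (hthick.1 P (hAfin.subset hP.subset)
      (hAcard ▸ ncard_lt_ncard hP hAfin)).isPreconnected
  have hCDs : IsSubcontinuum (C ∩ D) := ⟨hclosed.isCompact, hconn⟩
  exact ⟨hCDs, hBE, ⟨hCDs, hBE, hcover, hinter⟩, hconn.nonempty, hclosed, hconn, hcover, hinter⟩
end

section
/- Let P be a set with a pretree structure and let R be a partition of P into convex subsets. Define an interval relation on R by: for A, B, C ∈ R, A ∈ (B,C) if and only if A, B, C are pairwise distinct and there exist a ∈ A, b ∈ B, c ∈ C with a ∈ (b,c) in P. Then R with this interval relation is a pretree, i.e. it satisfies: (1) (B,C) = (C,B) for all B, C ∈ R; (2) [B,D] ⊆ [B,C] ∪ [C,D] for all B, C, D ∈ R; (3) if C ∈ (B,D) then B ∉ (C,D). -/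
/-- A pretree structure on a set `P`: an interval assignment `(x,y) ⊆ P` which is symmetric,
satisfies the interval transitivity axiom `[x,z] ⊆ [x,y] ∪ [y,z]`, and such that
`z ∈ (x,y)` implies `x ∉ (z,y)`. -/
structure PretreeStruct (P : Type*) where
  int : P → P → Set P
  int_symm : ∀ x y, int x y = int y x
  int_trans : ∀ x y z : P,
    int x z ∪ {x, z} ⊆ (int x y ∪ {x, y}) ∪ (int y z ∪ {y, z})
  int_antisym : ∀ x y z : P, z ∈ int x y → x ∉ int z y

namespace PretreeStruct

variable {P : Type*} (T : PretreeStruct P)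

theorem mem_int_trans {x z a : P} (y : P) (h : a ∈ T.int x z) (hx : a ≠ x) (hy : a ≠ y)
    (hz : a ≠ z) : a ∈ T.int x y ∨ a ∈ T.int y z := by
  have := T.int_trans x y z (Or.inl h)
  simpa [hx, hy, hz] using this

/-- Moving the left endpoint of an interval inside a convex set `B` preserves membership of
points outside `B`. -/
theorem mem_int_of_convex_left {B : Set P} (hB : ∀ x ∈ B, ∀ y ∈ B, T.int x y ⊆ B)
    {a b b' c : P} (hb : b ∈ B) (hb' : b' ∈ B) (ha : a ∉ B) (hac : a ≠ c)
    (h : a ∈ T.int b c) : a ∈ T.int b' c :=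
  (T.mem_int_trans b' h (ne_of_mem_of_not_mem hb ha).symm
    (ne_of_mem_of_not_mem hb' ha).symm hac).resolve_left fun h' => ha (hB b hb b' hb' h')

theorem mem_int_of_convex_right {C : Set P} (hC : ∀ x ∈ C, ∀ y ∈ C, T.int x y ⊆ C)
    {a b c c' : P} (hc : c ∈ C) (hc' : c' ∈ C) (ha : a ∉ C) (hab : a ≠ b)
    (h : a ∈ T.int b c) : a ∈ T.int b c' := by
  rw [T.int_symm] at h ⊢
  exact T.mem_int_of_convex_left hC hc hc' ha hab h

end PretreeStruct

/-- **Theorem (pretree quotient).** Let `P` be a pretree and `R` a partition of `P` into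
convex subsets.  Define, for `A, B, C ∈ R`: `A ∈ (B,C)` iff `A, B, C` are pairwise distinct
and there exist `a ∈ A`, `b ∈ B`, `c ∈ C` with `a ∈ (b,c)` in `P`.  Then `R` with this
interval relation is a pretree. -/
theorem pretreeQuotient {P : Type*} (T : PretreeStruct P) (R : Set (Set P))
    (hpart : Setoid.IsPartition R)
    (hconv : ∀ A ∈ R, ∀ a ∈ A, ∀ b ∈ A, T.int a b ⊆ A) :
    ∃ S : PretreeStruct {A : Set P // A ∈ R},
      ∀ B C A : {A : Set P // A ∈ R},
        A ∈ S.int B C ↔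
          (A ≠ B ∧ A ≠ C ∧ B ≠ C ∧
            ∃ a ∈ A.1, ∃ b ∈ B.1, ∃ c ∈ C.1, a ∈ T.int b c) := by
  have hdisj : ∀ {A B : {A : Set P // A ∈ R}} {x : P}, A ≠ B → x ∈ A.1 → x ∉ B.1 :=
    fun {A B x} hne hA hB => hne <| Subtype.ext <|
      (hpart.2 x).unique ⟨A.2, hA⟩ ⟨B.2, hB⟩
  have hne : ∀ {A B : {A : Set P // A ∈ R}} {x y : P}, A ≠ B → x ∈ A.1 → y ∈ B.1 → x ≠ y :=
    fun h hA hB => (ne_of_mem_of_not_mem hB (hdisj h hA)).symm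
  refine ⟨⟨fun B C => {A | A ≠ B ∧ A ≠ C ∧ B ≠ C ∧
    ∃ a ∈ A.1, ∃ b ∈ B.1, ∃ c ∈ C.1, a ∈ T.int b c}, ?_, ?_, ?_⟩, fun _ _ _ => Iff.rfl⟩
  · have hsub : ∀ B C A : {A : Set P // A ∈ R},
        (A ≠ B ∧ A ≠ C ∧ B ≠ C ∧ ∃ a ∈ A.1, ∃ b ∈ B.1, ∃ c ∈ C.1, a ∈ T.int b c) →
        (A ≠ C ∧ A ≠ B ∧ C ≠ B ∧ ∃ a ∈ A.1, ∃ c ∈ C.1, ∃ b ∈ B.1, a ∈ T.int c b) := by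
      rintro B C A ⟨hAB, hAC, hBC, a, ha, b, hb, c, hc, h⟩
      exact ⟨hAC, hAB, hBC.symm, a, ha, c, hc, b, hb, T.int_symm b c ▸ h⟩
    exact fun B C => Set.ext fun A => ⟨hsub B C A, hsub C B A⟩
  · rintro B C D A (hA | rfl | rfl)
    · by_cases hAC : A = C
      · exact Or.inl (Or.inr (Or.inr hAC))
      by_cases hBC : B = C
      · subst hBC
        exact Or.inr (Or.inl hA)
      by_cases hCD : C = D
      · subst hCD
        exact Or.inl (Or.inl hA)
      obtain ⟨hAB, hAD, -, a, ha, b, hb, d, hd, h⟩ := hA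
      obtain ⟨c, hc⟩ := Setoid.nonempty_of_mem_partition hpart C.2
      rcases T.mem_int_trans c h (hne hAB ha hb) (hne hAC ha hc) (hne hAD ha hd) with h | h
      · exact Or.inl (Or.inl ⟨hAB, hAC, hBC, a, ha, b, hb, c, hc, h⟩)
      · exact Or.inr (Or.inl ⟨hAC, hAD, hCD, a, ha, c, hc, d, hd, h⟩)
    · exact Or.inl (Or.inr (Or.inl rfl))
    · exact Or.inr (Or.inr (Or.inr rfl))
  · rintro B D C ⟨hCB, hCD, hBD, c, hc, b, hb, d, hd, h⟩
      ⟨-, -, -, b', hb', c', hc', d', hd', h'⟩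
    have hc_mem : c ∈ T.int b' d' :=
      T.mem_int_of_convex_right (hconv D.1 D.2) hd hd' (hdisj hCD hc) (hne hCB hc hb')
        (T.mem_int_of_convex_left (hconv B.1 B.2) hb hb' (hdisj hCB hc) (hne hCD hc hd) h)
    exact T.int_antisym b' d' c hc_mem
      (T.mem_int_of_convex_left (hconv C.1 C.2) hc' hc (hdisj hCB.symm hb')
        (hne hBD hb' hd') h')
end

section
/- Let K be the Cantor space (for instance ℕ → Bool with the product topology) and let Z be the quotient space of K × [0,1] obtained by collapsing K × {0} to a single point a and K × {1} to a single point b (the suspension of K, with suspension points a and b). Then: (i) for every finite set F ⊆ Z such that Z \ F is disconnected, one has {a, b} ⊆ F; (ii) Z \ {a, b} is disconnected. Consequently {a, b} is the unique minimal finite cut of Z: if F ⊆ Z is finite, Z \ F is disconnected, and Z \ F' is connected for every proper subset F' ⊊ F, then F = {a, b}. -/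
open Set

/-- The suspension identification on (Cantor set) × [0,1]: collapse the bottom
`K × {0}` to one point and the top `K × {1}` to another point. -/
def SuspRel (p q : (ℕ → Bool) × unitInterval) : Prop :=
  p = q ∨ (p.2 = 0 ∧ q.2 = 0) ∨ (p.2 = 1 ∧ q.2 = 1)

/-- The suspension of the Cantor set `ℕ → Bool`. -/
def CantorSusp : Type := Quot SuspRel

instance : TopologicalSpace CantorSusp :=
  inferInstanceAs (TopologicalSpace (Quot SuspRel))

/-- The bottom suspension point `a`. -/
def suspPtA : CantorSusp := Quot.mk SuspRel (fun _ => false, 0)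

/-- The top suspension point `b`. -/
def suspPtB : CantorSusp := Quot.mk SuspRel (fun _ => false, 1)

/-- The fibre of the suspension over which a point lies, with `none` for both suspension points. -/
noncomputable def CantorSusp.fibre : CantorSusp → Option (ℕ → Bool) :=
  open Classical in
  Quot.lift (fun p => if p.2 = 0 ∨ p.2 = 1 then none else some p.1) (by
    rintro p q (rfl | ⟨hp, hq⟩ | ⟨hp, hq⟩)
    · rfl
    · simp [hp, hq]
    · simp [hp, hq])

lemma CantorSusp.fibre_mk {x : ℕ → Bool} {t : unitInterval} (h0 : t ≠ 0) (h1 : t ≠ 1) :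
    CantorSusp.fibre (Quot.mk SuspRel (x, t)) = some x := by
  simp [CantorSusp.fibre, h0, h1]

lemma CantorSusp.fibre_mk_eq_some_iff {x y : ℕ → Bool} {t : unitInterval} :
    CantorSusp.fibre (Quot.mk SuspRel (x, t)) = some y ↔ (t ≠ 0 ∧ t ≠ 1) ∧ x = y := by
  by_cases h : t = 0 ∨ t = 1
  · rcases h with h | h <;> simp [CantorSusp.fibre, h]
  · push Not at h
    simp [CantorSusp.fibre_mk h.1 h.2, h.1, h.2]

lemma CantorSusp.mk_zero (x : ℕ → Bool) : Quot.mk SuspRel (x, 0) = suspPtA :=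
  Quot.sound (Or.inr (Or.inl ⟨rfl, rfl⟩))

lemma CantorSusp.mk_one (x : ℕ → Bool) : Quot.mk SuspRel (x, 1) = suspPtB :=
  Quot.sound (Or.inr (Or.inr ⟨rfl, rfl⟩))

lemma CantorSusp.continuous_mk :
    Continuous (Quot.mk SuspRel : (ℕ → Bool) × unitInterval → CantorSusp) :=
  continuous_quot_mk

lemma dense_compl_of_finite_cantor {B : Set (ℕ → Bool)} (hB : B.Finite) : Dense Bᶜ := by
  have : ∀ x : ℕ → Bool, (nhdsWithin x {x}ᶜ).NeBot := by
    intro x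
    have hne : ∀ n, Function.update x n (!x n) ≠ x := fun n h => by
      simpa using congrFun h n
    have hlim : Filter.Tendsto (fun n => Function.update x n (!x n)) Filter.atTop (nhds x) := by
      refine tendsto_pi_nhds.2 fun k => tendsto_const_nhds.congr' ?_
      filter_upwards [Filter.eventually_gt_atTop k] with n hn
      rw [Function.update_of_ne hn.ne]
    exact (tendsto_nhdsWithin_iff.2 ⟨hlim, Filter.Eventually.of_forall hne⟩).neBot
  rw [compl_eq_univ_sdiff]
  exact dense_univ.sdiff_finite hB

/-- A finite set missing a point `p` of the suspension does not cut it, provided all fibres can be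
joined to `p` within a connected dense set of heights. -/
lemma CantorSusp.isPreconnected_compl {F : Set CantorSusp} (hF : F.Finite) {p : CantorSusp}
    (hp : p ∉ F) {e : unitInterval} (he : ∀ x, Quot.mk SuspRel (x, e) = p)
    {C : Set unitInterval} (hC : IsPreconnected C) (hCd : Dense C) (heC : e ∈ C)
    (hCe : ∀ t ∈ C, t ≠ e → t ≠ 0 ∧ t ≠ 1) : IsPreconnected Fᶜ := by
  set B : Set (ℕ → Bool) := some ⁻¹' (CantorSusp.fibre '' F)
  have hB : B.Finite := (hF.image _).preimage (Option.some_injective _).injOn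
  set D : Set CantorSusp := Quot.mk SuspRel '' (Bᶜ ×ˢ C)
  have hDF : D ⊆ Fᶜ := by
    rintro _ ⟨⟨x, t⟩, ⟨hx, ht⟩, rfl⟩ hmem
    by_cases hte : t = e
    · subst hte
      exact hp (he x ▸ hmem)
    · obtain ⟨h0, h1⟩ := hCe t ht hte
      exact hx ⟨_, hmem, CantorSusp.fibre_mk h0 h1⟩
  have hDd : Dense D :=
    (Quot.mk_surjective.denseRange).dense_image CantorSusp.continuous_mk
      ((dense_compl_of_finite_cantor hB).prod hCd)
  have hDc : IsPreconnected D := by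
    refine isPreconnected_of_forall p ?_
    rintro _ ⟨⟨x, t⟩, ⟨hx, ht⟩, rfl⟩
    refine ⟨(fun s => Quot.mk SuspRel (x, s)) '' C, ?_, ⟨e, heC, he x⟩, ⟨t, ht, rfl⟩, ?_⟩
    · rintro _ ⟨s, hs, rfl⟩
      exact ⟨(x, s), ⟨hx, hs⟩, rfl⟩
    · exact hC.image _ (CantorSusp.continuous_mk.comp (by fun_prop)).continuousOn
  exact hDc.subset_closure hDF (by simp [hDd.closure_eq])

lemma CantorSusp.suspPts_subset_of_cut {F : Set CantorSusp} (hF : F.Finite)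
    (hcut : ¬ IsPreconnected Fᶜ) : {suspPtA, suspPtB} ⊆ F := by
  have h01 : (0 : unitInterval) < 1 := zero_lt_one
  rintro z (rfl | rfl) <;> by_contra hz <;> refine hcut ?_
  · refine CantorSusp.isPreconnected_compl hF hz CantorSusp.mk_zero
      (isPreconnected_Iio (a := 1)) ?_ h01 fun t ht h => ⟨h, ne_of_lt ht⟩
    rw [dense_iff_closure_eq, closure_Iio' (a := (1 : unitInterval)) ⟨0, h01⟩]
    exact eq_univ_of_forall fun t => unitInterval.le_one'
  · refine CantorSusp.isPreconnected_compl hF hz CantorSusp.mk_one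
      (isPreconnected_Ioi (a := 0)) ?_ h01 fun t ht h => ⟨ne_of_gt ht, h⟩
    rw [dense_iff_closure_eq, closure_Ioi' (a := (0 : unitInterval)) ⟨1, h01⟩]
    exact eq_univ_of_forall fun t => unitInterval.nonneg'

/-- The open part of the suspension over the sequences whose first term is `c`. -/
def CantorSusp.openHalf (c : Bool) : Set CantorSusp :=
  {z | ∃ x, CantorSusp.fibre z = some x ∧ x 0 = c}

lemma CantorSusp.mk_mem_openHalf {c : Bool} {x : ℕ → Bool} {t : unitInterval} :
    Quot.mk SuspRel (x, t) ∈ CantorSusp.openHalf c ↔ (t ≠ 0 ∧ t ≠ 1) ∧ x 0 = c := by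
  constructor
  · rintro ⟨y, hy, hc⟩
    obtain ⟨ht, rfl⟩ := CantorSusp.fibre_mk_eq_some_iff.1 hy
    exact ⟨ht, hc⟩
  · rintro ⟨ht, hc⟩
    exact ⟨x, CantorSusp.fibre_mk_eq_some_iff.2 ⟨ht, rfl⟩, hc⟩

lemma CantorSusp.isOpen_openHalf (c : Bool) : IsOpen (CantorSusp.openHalf c) := by
  have hpre : Quot.mk SuspRel ⁻¹' CantorSusp.openHalf c =
      {p : (ℕ → Bool) × unitInterval | (p.2 ≠ 0 ∧ p.2 ≠ 1) ∧ p.1 0 = c} := by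
    ext ⟨x, t⟩
    exact CantorSusp.mk_mem_openHalf
  refine isQuotientMap_quot_mk.isOpen_preimage.1 ?_
  rw [hpre]
  refine ((isOpen_ne_fun continuous_snd continuous_const).inter
    (isOpen_ne_fun continuous_snd continuous_const)).inter ?_
  have hcont : Continuous fun p : (ℕ → Bool) × unitInterval => p.1 0 := by fun_prop
  exact (isOpen_discrete ({c} : Set Bool)).preimage hcont

lemma CantorSusp.openHalf_subset (c : Bool) :
    CantorSusp.openHalf c ⊆ {suspPtA, suspPtB}ᶜ := by
  rintro z hz (rfl | rfl)
  · exact (CantorSusp.mk_mem_openHalf.1 hz).1.1 rfl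
  · exact (CantorSusp.mk_mem_openHalf.1 hz).1.2 rfl

lemma CantorSusp.openHalf_nonempty (c : Bool) : (CantorSusp.openHalf c).Nonempty := by
  obtain ⟨t, h0, h1⟩ := exists_between (zero_lt_one : (0 : unitInterval) < 1)
  exact ⟨Quot.mk SuspRel (fun _ => c, t), CantorSusp.mk_mem_openHalf.2 ⟨⟨h0.ne', h1.ne⟩, rfl⟩⟩

lemma CantorSusp.not_isPreconnected_compl_suspPts :
    ¬ IsPreconnected ({suspPtA, suspPtB}ᶜ : Set CantorSusp) := by
  intro h
  have hcover : ({suspPtA, suspPtB}ᶜ : Set CantorSusp) ⊆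
      CantorSusp.openHalf false ∪ CantorSusp.openHalf true := by
    rintro ⟨x, t⟩ hz
    have h0 : t ≠ 0 := by
      rintro rfl
      exact hz (Or.inl (CantorSusp.mk_zero x))
    have h1 : t ≠ 1 := by
      rintro rfl
      exact hz (Or.inr (CantorSusp.mk_one x))
    cases hx : x 0
    · exact Or.inl (CantorSusp.mk_mem_openHalf.2 ⟨⟨h0, h1⟩, hx⟩)
    · exact Or.inr (CantorSusp.mk_mem_openHalf.2 ⟨⟨h0, h1⟩, hx⟩)
  have hmeet (c : Bool) : ({suspPtA, suspPtB}ᶜ ∩ CantorSusp.openHalf c).Nonempty := by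
    rw [inter_eq_right.2 (CantorSusp.openHalf_subset c)]
    exact CantorSusp.openHalf_nonempty c
  obtain ⟨z, -, ⟨x, hx, hx0⟩, ⟨y, hy, hy0⟩⟩ := h _ _ (CantorSusp.isOpen_openHalf false)
    (CantorSusp.isOpen_openHalf true) hcover (hmeet false) (hmeet true)
  obtain rfl : x = y := Option.some_injective _ (hx.symm.trans hy)
  simp [hx0] at hy0


/-- **Lemma (suspension).** In the suspension `Z` of the Cantor set, with suspension points
`a` and `b`: (i) every finite cut of `Z` contains `{a, b}`; (ii) `{a, b}` is a cut of `Z`;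
consequently (iii) `{a, b}` is the unique minimal finite cut of `Z`. -/
theorem cantorSuspension_cuts :
    (∀ F : Set CantorSusp, F.Finite → ¬ IsPreconnected Fᶜ →
      {suspPtA, suspPtB} ⊆ F) ∧
    (¬ IsPreconnected ({suspPtA, suspPtB}ᶜ : Set CantorSusp)) ∧
    (∀ F : Set CantorSusp, F.Finite → ¬ IsPreconnected Fᶜ →
      (∀ F' : Set CantorSusp, F' ⊂ F → IsConnected F'ᶜ) →
      F = {suspPtA, suspPtB}) := by
  refine ⟨fun F hF hcut => CantorSusp.suspPts_subset_of_cut hF hcut,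
    CantorSusp.not_isPreconnected_compl_suspPts, fun F hF hcut hmin => ?_⟩
  by_contra hne
  have hss : {suspPtA, suspPtB} ⊂ F :=
    (CantorSusp.suspPts_subset_of_cut hF hcut).ssubset_of_ne (Ne.symm hne)
  exact CantorSusp.not_isPreconnected_compl_suspPts (hmin _ hss).isPreconnected
end

section
/- Let G be a group acting on a set Ω such that G does not virtually fix a point, i.e. every G-orbit in Ω is infinite. Then for every finite subset A ⊆ Ω there exists g ∈ G such that g • A ∩ A = ∅. -/
open Pointwise

/-- **Lemma (P. M. Neumann).** Suppose a group `G` acts on a set `Ω` without virtually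
fixing a point, i.e. every `G`-orbit is infinite.  Then for every finite subset `A ⊆ Ω`
there is some `g ∈ G` with `g • A ∩ A = ∅`. -/
theorem neumann_disjoint_translate {G : Type*} [Group G] {Ω : Type*} [MulAction G Ω]
    (horb : ∀ ω : Ω, (MulAction.orbit G ω).Infinite)
    {A : Set Ω} (hA : A.Finite) :
    ∃ g : G, (g • A) ∩ A = ∅ := by
  by_contra! h
  have hmeet : ∀ g : G, ∃ a ∈ A, g • a ∈ A := by
    intro g
    obtain ⟨_, ⟨a, ha, rfl⟩, hga⟩ := h g
    exact ⟨a, ha, hga⟩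
  have htransport : ∀ p : Ω × Ω, ∃ t : G, p.2 ∈ MulAction.orbit G p.1 → t • p.1 = p.2 := by
    intro p
    by_cases hp : p.2 ∈ MulAction.orbit G p.1
    · obtain ⟨t, ht⟩ := hp
      exact ⟨t, fun _ => ht⟩
    · exact ⟨1, fun hp' => absurd hp' hp⟩
  choose t ht using htransport
  have hcovers : ⋃ p ∈ hA.toFinset ×ˢ hA.toFinset,
      t p • (MulAction.stabilizer G p.1 : Set G) = Set.univ := by
    refine Set.eq_univ_of_forall fun g => ?_
    obtain ⟨a, ha, hga⟩ := hmeet g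
    refine Set.mem_biUnion (x := (a, g • a)) (by simp [ha, hga]) ?_
    rw [mem_leftCoset_iff, SetLike.mem_coe, MulAction.mem_stabilizer_iff, mul_smul,
      inv_smul_eq_iff]
    exact (ht (a, g • a) ⟨g, rfl⟩).symm
  obtain ⟨p, -, hp⟩ := Subgroup.exists_finiteIndex_of_leftCoset_cover hcovers
  refine horb p.1 (Set.finite_coe_iff.mp ?_)
  exact Finite.of_equiv _ (MulAction.orbitEquivQuotientStabilizer G p.1).symm
end
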